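/- High-temperature expansion of the Ising model: for any ribbon graph G without flags, real β and real coupling constants J_e for each edge, the Ising partition function Z = Σ_{σ: V(G)→{−1,+1}} Π_{e∈E(G)} exp(β J_e σ_u σ_{u'}) (where u, u' are the vertices incident to the two half-edges of e, possibly equal) satisfies Z = Q_G(x, 0, 0, w, r) with x_e = cosh(β J_e), w_e = sinh(β J_e), r_{2n} = 2 and r_{2n+1} = 0; equivalently, Z = 2^{v(G)} Σ_{C ⊆ E(G), C even} (Π_{e∉C} cosh(β J_e))(Π_{e∈C} sinh(β J_e)), the sum being over edge subsets C such that every vertex is incident to an even number of half-edges of edges of C. -/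

import Mathlib

set_option linter.unusedSectionVars false

open Finset

namespace RibbonPaper

variable {X : Type} [Fintype X] [DecidableEq X]

/-- Raw combinatorial data of a ribbon graph with flags: three permutations of
the finite set of crosses. -/
structure RawRibbon (X : Type) [Fintype X] [DecidableEq X] where
  s0 : Equiv.Perm X
  th : Equiv.Perm X
  s1 : Equiv.Perm X

namespace RawRibbon

/-- The axioms of a combinatorial map with flags (ribbon graph with flags). -/
def IsRibbon (G : RawRibbon X) : Prop :=
  G.th ^ 2 = 1 ∧ G.s1 ^ 2 = 1 ∧ G.th * G.s1 = G.s1 * G.th ∧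
    (∀ x, G.th x ≠ x) ∧ (∀ x, G.th x ≠ G.s1 x) ∧
    G.s0 * G.th = G.th * G.s0⁻¹ ∧
    ∀ (x : X) (n : ℤ), (G.s0 ^ n) x ≠ G.th x

/-- A ribbon graph without flags: `σ₁` is fixed-point free. -/
def NoFlags (G : RawRibbon X) : Prop := ∀ x, G.s1 x ≠ x

/-- The edges: 4-element orbits `{x, θx, σ₁x, σ₁θx}` of crosses not fixed by `σ₁`. -/
def edges (G : RawRibbon X) : Finset (Finset X) :=
  (Finset.univ.filter fun x => G.s1 x ≠ x).image
    fun x => ({x, G.th x, G.s1 x, G.s1 (G.th x)} : Finset X)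

/-- The flags: pairs `{x, θ x}` of crosses fixed by `σ₁`. -/
def flags (G : RawRibbon X) : Finset (Finset X) :=
  (Finset.univ.filter fun x => G.s1 x = x).image fun x => ({x, G.th x} : Finset X)

/-- The half-ribbons: all pairs `{x, θ x}`. -/
def halfRibbons (G : RawRibbon X) : Finset (Finset X) :=
  Finset.univ.image fun x => ({x, G.th x} : Finset X)

/-- Orbit of a point under a permutation, as a finset. -/
def permOrbit (f : Equiv.Perm X) (x : X) : Finset X :=
  (Finset.range (Fintype.card X)).image fun n => (f ^ n) x

/-- The vertex containing the cross `x`: the union of the `σ₀`-cycles of `x` and `θ x`. -/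
def vertexOf (G : RawRibbon X) (x : X) : Finset X :=
  permOrbit G.s0 x ∪ permOrbit G.s0 (G.th x)

/-- The vertices of the ribbon graph, as finsets of crosses. -/
def vertices (G : RawRibbon X) : Finset (Finset X) :=
  Finset.univ.image G.vertexOf

/-- `degB G B v` : the number of half-edges incident to `v` that belong to edges of `B`,
plus the number of flags incident to `v`. -/
def degB (G : RawRibbon X) (B : Finset (Finset X)) (v : Finset X) : ℕ :=
  (G.halfRibbons.filter fun h => h ⊆ v ∧ (h ∈ G.flags ∨ ∃ e ∈ B, h ⊆ e)).card

/-- `φ_S` : the permutation agreeing with `f` on `S` and the identity off `S`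
(defined whenever `S` is `f`-invariant, and the identity otherwise). -/
def permRestrict (f : Equiv.Perm X) (S : Finset X) : Equiv.Perm X :=
  if h : ∀ x : X, x ∈ S ↔ f x ∈ S then Equiv.Perm.ofSubtype (f.subtypePerm (p := fun x => x ∈ S) fun x => (h x).symm) else 1

/-- The set of crosses of a set of edges. -/
def crossSet (E' : Finset (Finset X)) : Finset X := E'.biUnion id

/-- Chmutov's partial dual `G^{E'}`. -/
def partialDual (G : RawRibbon X) (E' : Finset (Finset X)) : RawRibbon X where
  s0 := G.s0 * permRestrict G.th (crossSet E') * permRestrict G.s1 (crossSet E')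
  th := permRestrict G.s1 (crossSet E') * permRestrict G.th (crossSet E')ᶜ
  s1 := permRestrict G.s1 (crossSet E')ᶜ * permRestrict G.th (crossSet E')

/-- The topological polynomial `Q` of a ribbon graph with flags. -/
def Qpoly {R : Type} [CommRing R] (G : RawRibbon X) (x y z w : Finset X → R) (r : ℕ → R) : R :=
  ∑ A ∈ G.edges.powerset, ∑ B ∈ (G.partialDual A).edges.powerset,
    (∏ e ∈ (G.edges \ A) ∩ ((G.partialDual A).edges \ B), x e) *
      (∏ e ∈ A ∩ ((G.partialDual A).edges \ B), y e) *
      (∏ e ∈ A ∩ B, z e) *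
      (∏ e ∈ (G.edges \ A) ∩ B, w e) *
      ∏ v ∈ (G.partialDual A).vertices, r (degB (G.partialDual A) B v)

/-- The first hyperbolic polynomial `HU` as an evaluation of `Q`. -/
noncomputable def HU (G : RawRibbon X) (Ω t : Finset X → ℝ) : ℝ :=
  Qpoly G t Ω (fun e => Ω e * t e ^ 2) (fun e => t e * Ω e ^ 2)
    fun n => if Even n then 0 else 2

end RawRibbon

end RibbonPaper

theorem test : True := trivial
namespace RibbonPaper

namespace RawRibbon

variable {X : Type} [Fintype X] [DecidableEq X]

lemma firstRet_exists (f : Equiv.Perm X) (S : Finset X) {x : X} (hx : x ∈ S) :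
    ∃ k : ℕ, 0 < k ∧ (f ^ k) x ∈ S :=
  ⟨orderOf f, orderOf_pos f, by rw [pow_orderOf_eq_one]; simpa using hx⟩

open scoped Classical in
/-- The first-return map of a permutation on a subset. -/
noncomputable def firstRet (f : Equiv.Perm X) (S : Finset X) (x : X) : X :=
  if h : ∃ k : ℕ, 0 < k ∧ (f ^ k) x ∈ S then (f ^ Nat.find h) x else x

lemma firstRet_mem (f : Equiv.Perm X) (S : Finset X) {x : X} (hx : x ∈ S) :
    firstRet f S x ∈ S := by
  rw [firstRet, dif_pos (firstRet_exists f S hx)]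
  exact (Nat.find_spec (firstRet_exists f S hx)).2

lemma firstRet_inj_aux (f : Equiv.Perm X) (S : Finset X) {x y : X}
    (hx : x ∈ S) (hy : y ∈ S)
    (hle : Nat.find (firstRet_exists f S hx) ≤ Nat.find (firstRet_exists f S hy))
    (h : firstRet f S x = firstRet f S y) : x = y := by
  have hex := firstRet_exists f S hx
  have hey := firstRet_exists f S hy
  rw [firstRet, dif_pos hex, firstRet, dif_pos hey] at h
  have hxy : x = (f ^ (Nat.find hey - Nat.find hex)) y := by
    apply Equiv.injective (f ^ Nat.find hex)
    rw [← Equiv.Perm.mul_apply, ← pow_add, Nat.add_sub_cancel' hle]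
    exact h
  by_cases h0 : Nat.find hey - Nat.find hex = 0
  · rw [h0, pow_zero] at hxy
    simpa using hxy
  · exfalso
    have hlt : Nat.find hey - Nat.find hex < Nat.find hey :=
      Nat.sub_lt (Nat.find_spec hey).1 (Nat.find_spec hex).1
    apply Nat.find_min hey hlt
    refine ⟨Nat.pos_of_ne_zero h0, ?_⟩
    rw [hxy] at hx
    exact hx

lemma firstRet_inj (f : Equiv.Perm X) (S : Finset X) {x y : X}
    (hx : x ∈ S) (hy : y ∈ S) (h : firstRet f S x = firstRet f S y) : x = y := by
  rcases le_total (Nat.find (firstRet_exists f S hx)) (Nat.find (firstRet_exists f S hy)) with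
    hle | hle
  · exact firstRet_inj_aux f S hx hy hle h
  · exact (firstRet_inj_aux f S hy hx hle h.symm).symm

/-- The permutation induced on a subset `S` by a permutation of `X`
(the first-return map). -/
noncomputable def inducedPerm (f : Equiv.Perm X) (S : Finset X) : Equiv.Perm {x : X // x ∈ S} :=
  Equiv.ofBijective (fun a => ⟨firstRet f S a.1, firstRet_mem f S a.2⟩)
    (Finite.injective_iff_bijective.mp fun a b hab =>
      Subtype.ext (firstRet_inj f S a.2 b.2 (congrArg Subtype.val hab)))

/-- The ribbon graph obtained by restricting to a subset `S` of the crosses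
(deleting all crosses outside `S`). -/
noncomputable def restrict (G : RawRibbon X) (S : Finset X) : RawRibbon {x : X // x ∈ S} :=
  ⟨inducedPerm G.s0 S, inducedPerm G.th S, inducedPerm G.s1 S⟩

/-- Deletion of an edge `e` (given by its finset of crosses). -/
noncomputable def delete (G : RawRibbon X) (e : Finset X) : RawRibbon {x : X // x ∈ eᶜ} :=
  G.restrict eᶜ

/-- The cut of an edge `e`: `σ₁` is replaced by `(σ₁)_{X∖e}`, so the two
half-edges of `e` become flags. -/
def cut (G : RawRibbon X) (e : Finset X) : RawRibbon X :=
  ⟨G.s0, G.th, permRestrict G.s1 eᶜ⟩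

/-- Connectivity: the crosses form a single orbit under the group generated by the
three permutations. -/
def Connected (G : RawRibbon X) : Prop :=
  ∀ x y : X, ∃ g ∈ Subgroup.closure ({G.s0, G.th, G.s1} : Set (Equiv.Perm X)), g x = y

/-- Two vertices are linked by an edge of `A` if `e ∈ A` has a half-edge incident to each. -/
def linked (G : RawRibbon X) (A : Finset (Finset X)) (u v : Finset X) : Prop :=
  ∃ e ∈ A, (∃ h ∈ G.halfRibbons, h ⊆ e ∧ h ⊆ u) ∧ ∃ h ∈ G.halfRibbons, h ⊆ e ∧ h ⊆ v

/-- Connectivity of two vertices in the spanning subgraph `(V(G), A)`. -/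
def vconn (G : RawRibbon X) (A : Finset (Finset X)) : Finset X → Finset X → Prop :=
  Relation.ReflTransGen (G.linked A)

/-- The spanning subgraph `(V(G), A)` is connected. -/
def SpanningConn (G : RawRibbon X) (A : Finset (Finset X)) : Prop :=
  ∀ u ∈ G.vertices, ∀ v ∈ G.vertices, G.vconn A u v

/-- The number of faces (boundary components) of a ribbon graph: the number of
vertices of its natural dual. -/
def nFaces (G : RawRibbon X) : ℕ := (G.partialDual G.edges).vertices.card

/-- The number of boundary components of the spanning subgraph of `G` with surviving
crosses `S`, counting also the vertices of `G` that have become isolated. -/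
noncomputable def nBoundary (G : RawRibbon X) (S : Finset X) : ℕ :=
  (G.restrict S).nFaces + (G.vertices.filter fun v => Disjoint v S).card

/-- A spanning quasi-tree: the spanning subgraph `(V(G), A)` is connected and has
exactly one face. -/
def IsQuasiTree (G : RawRibbon X) (A : Finset (Finset X)) : Prop :=
  G.SpanningConn A ∧ G.nBoundary (crossSet A) = 1

/-- A spanning tree: the spanning subgraph `(V(G), A)` is connected and
`|A| = v(G) - 1`. -/
def IsSpanningTree (G : RawRibbon X) (A : Finset (Finset X)) : Prop :=
  G.SpanningConn A ∧ A.card + 1 = G.vertices.card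

open scoped Classical in
/-- The first Symanzik polynomial of the noncommutative heat-kernel theory. -/
noncomputable def Upoly (G : RawRibbon X) (α : Finset X → ℝ) (θ : ℝ) : ℝ :=
  ∑ A ∈ G.edges.powerset.filter (fun A => G.IsQuasiTree A),
    (θ / 2) ^ (A.card + 1 - G.vertices.card) * ∏ e ∈ G.edges \ A, α e

end RawRibbon

end RibbonPaper
namespace RibbonPaper

namespace RawRibbon

variable {X : Type} [Fintype X] [DecidableEq X]

/-- Even spanning subgraphs of `G`. -/
def evenSubs (G : RawRibbon X) : Finset (Finset (Finset X)) :=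
  G.edges.powerset.filter fun B => ∀ v ∈ G.vertices, Even (G.degB B v)

/-- Odd spanning subgraphs of `G`. -/
def oddSubs (G : RawRibbon X) : Finset (Finset (Finset X)) :=
  G.edges.powerset.filter fun B => ∀ v ∈ G.vertices, Odd (G.degB B v)

/-- Odd cutting spanning subgraphs of `G`: subsets of half-ribbons such that every
vertex is incident to an odd number of them. -/
def oddCutting (G : RawRibbon X) : Finset (Finset (Finset X)) :=
  G.halfRibbons.powerset.filter fun H =>
    ∀ v ∈ G.vertices, Odd ((H.filter fun h => h ⊆ v).card)

/-- Even cutting spanning subgraphs of `G`. -/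
def evenCutting (G : RawRibbon X) : Finset (Finset (Finset X)) :=
  G.halfRibbons.powerset.filter fun H =>
    ∀ v ∈ G.vertices, Even ((H.filter fun h => h ⊆ v).card)

/-- The flag-set of a cutting spanning subgraph `H`: the flags of `G` contained in `H`
together with the edges exactly one of whose two half-edges lies in `H`. -/
def flagSetOf (G : RawRibbon X) (H : Finset (Finset X)) : Finset (Finset X) :=
  (G.flags ∩ H) ∪ (G.edges.filter fun e => (H.filter fun h => h ⊆ e).card = 1)

/-- Orientability of a ribbon graph with flags. -/
def Orientable (G : RawRibbon X) : Prop :=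
  ∃ Xp : Finset X,
    Xp.image G.s0 = Xp ∧ Disjoint Xp (Xp.image G.th) ∧
      Xp ∪ Xp.image G.th = Finset.univ ∧
      ∀ x : X, G.s1 x ≠ x → (x ∈ Xp ↔ G.s1 x ∉ Xp)

/-- The edge variable of the edge of `G` containing the half-ribbon `h`
(as a product over the containing edges; a flag contributes `1`). -/
def halfWeight {R : Type} [CommRing R] (G : RawRibbon X) (t : Finset X → R)
    (h : Finset X) : R :=
  ∏ e ∈ G.edges.filter (fun e => h ⊆ e), t e

/-- The vertex containing a given half-ribbon. -/
def vertexOfHalf (G : RawRibbon X) (h : Finset X) : Finset X :=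
  (G.vertices.filter fun v => h ⊆ v).sup id

/-- The spin product `σ_u σ_{u'}` over the endpoints of an edge `e`, for the spin
configuration assigning `+1` to vertices in `T` and `-1` to the others. -/
noncomputable def spinProd (G : RawRibbon X) (T : Finset (Finset X)) (e : Finset X) : ℝ :=
  ∏ h ∈ G.halfRibbons.filter (fun h => h ⊆ e),
    (if G.vertexOfHalf h ∈ T then (1 : ℝ) else -1)

/-- An isolated vertex of even degree: incident to no half-edge and to an even
number of flags. -/
def IsIsolatedEvenVertex (G : RawRibbon X) (v : Finset X) : Prop :=
  v ∈ G.vertices ∧ (∀ h ∈ G.halfRibbons, h ⊆ v → h ∈ G.flags) ∧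
    Even ((G.flags.filter fun h => h ⊆ v).card)

open scoped Classical in
/-- The number of endpoints of edges of `B` lying in the `A`-connected component of the
vertex `v`, plus the number of flags attached to vertices of that component. -/
noncomputable def compDeg (G : RawRibbon X) (A B : Finset (Finset X)) (v : Finset X) : ℕ :=
  (G.halfRibbons.filter fun h =>
      (h ∈ G.flags ∨ ∃ e ∈ B, h ⊆ e) ∧ ∃ u ∈ G.vertices, G.vconn A v u ∧ h ⊆ u).card

/-- `(B, V(G/A))` is odd: every connected component of the spanning subgraph
`(V(G), A)` sees an odd number of endpoints of edges of `B` plus flags. -/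
def CompOdd (G : RawRibbon X) (A B : Finset (Finset X)) : Prop :=
  ∀ v ∈ G.vertices, Odd (compDeg G A B v)

open scoped Classical in
/-- The connected component of the vertex `v` in the spanning subgraph `(V(G), A)`. -/
noncomputable def compVerts (G : RawRibbon X) (A : Finset (Finset X)) (v : Finset X) :
    Finset (Finset X) :=
  G.vertices.filter fun u => G.vconn A v u

/-- The connected components of the spanning subgraph `(V(G), A)`. -/
noncomputable def components (G : RawRibbon X) (A : Finset (Finset X)) :
    Finset (Finset (Finset X)) :=
  G.vertices.image fun v => compVerts G A v

/-- The edges of `A` incident to a set of vertices `c`. -/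
def compEdges (G : RawRibbon X) (A : Finset (Finset X)) (c : Finset (Finset X)) :
    Finset (Finset X) :=
  A.filter fun e => ∃ h ∈ G.halfRibbons, h ⊆ e ∧ ∃ u ∈ c, h ⊆ u

open scoped Classical in
/-- The cycle edges of a (unicyclic) component `c`: those edges whose removal keeps
the component connected. -/
noncomputable def cycleEdges (G : RawRibbon X) (A : Finset (Finset X))
    (c : Finset (Finset X)) : Finset (Finset X) :=
  (compEdges G A c).filter fun e => ∀ u ∈ c, ∀ u' ∈ c, G.vconn (A.erase e) u u'

/-- The weight of a connected component in the commutative Mehler-kernel limit. -/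
noncomputable def compWeight (G : RawRibbon X) (A : Finset (Finset X)) (Ω t : Finset X → ℝ)
    (c : Finset (Finset X)) : ℝ :=
  if (compEdges G A c).card + 1 = c.card then
    (2 : ℝ) ^ (1 - ((compEdges G A c).card : ℤ)) *
      ∑ e ∈ compEdges G A c,
        Ω e ^ 2 * t e * ∏ e' ∈ (compEdges G A c).erase e, Ω e' * (1 + t e' ^ 2)
  else
    (2 : ℝ) ^ (2 - ((compEdges G A c).card : ℤ)) *
      ∑ C' ∈ (cycleEdges G A c).powerset.filter (fun C' => Odd C'.card),
        (∏ e ∈ C', Ω e * t e ^ 2) *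
          ∏ e' ∈ compEdges G A c \ cycleEdges G A c, Ω e' * (1 + t e' ^ 2)

/-- The graph `Ĝ_{i₀}` : the half-edge `i₀` (with crosses `x₀, θ x₀`) is detached from
its vertex, replaced there by a flag (crosses `inr 0, inr 1`), and attached to a new
bivalent vertex carrying one more flag (crosses `inr 2, inr 3`). -/
def hatGraph (G : RawRibbon X) (x₀ : X) : RawRibbon (X ⊕ Fin 4) where
  s0 :=
    (Equiv.swap (Sum.inl x₀) (Sum.inr 0) * Equiv.swap (Sum.inl (G.th x₀)) (Sum.inr 1)) *
        Equiv.sumCongr G.s0 (Equiv.refl (Fin 4)) *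
        (Equiv.swap (Sum.inl x₀) (Sum.inr 0) * Equiv.swap (Sum.inl (G.th x₀)) (Sum.inr 1))⁻¹ *
      Equiv.swap (Sum.inl x₀) (Sum.inr 2) * Equiv.swap (Sum.inl (G.th x₀)) (Sum.inr 3)
  th := Equiv.sumCongr G.th (Equiv.swap 0 1 * Equiv.swap 2 3)
  s1 := Equiv.sumCongr G.s1 (Equiv.refl (Fin 4))

end RawRibbon

end RibbonPaper

namespace RibbonPaper

namespace RawRibbon

section Ising

variable {X : Type} [Fintype X] [DecidableEq X]

lemma ising_mem_permOrbit (f : Equiv.Perm X) (x y : X) :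
    y ∈ permOrbit f x ↔ f.SameCycle x y := by
  unfold permOrbit
  simp only [Finset.mem_image, Finset.mem_range]
  constructor
  · rintro ⟨n, -, rfl⟩
    exact ⟨n, by simp⟩
  · intro h
    by_cases hx : x ∈ f.support
    · obtain ⟨i, hi, hxy⟩ := h.exists_pow_eq_of_mem_support hx
      exact ⟨i, lt_of_lt_of_le hi (Finset.card_le_univ _), hxy⟩
    · have hfx : f x = x := by simpa using hx
      obtain ⟨n, rfl⟩ := h
      refine ⟨0, Fintype.card_pos_iff.2 ⟨x⟩, ?_⟩
      rw [Equiv.Perm.zpow_apply_eq_self_of_apply_eq_self hfx]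
      rfl

lemma ising_th_th {G : RawRibbon X} (hG : G.IsRibbon) (x : X) : G.th (G.th x) = x := by
  have h := congrArg (fun p : Equiv.Perm X => p x) hG.1
  simpa [pow_two] using h

lemma ising_s1_s1 {G : RawRibbon X} (hG : G.IsRibbon) (x : X) : G.s1 (G.s1 x) = x := by
  have h := congrArg (fun p : Equiv.Perm X => p x) hG.2.1
  simpa [pow_two] using h

lemma ising_th_s1 {G : RawRibbon X} (hG : G.IsRibbon) (x : X) :
    G.th (G.s1 x) = G.s1 (G.th x) := by
  have h := congrArg (fun p : Equiv.Perm X => p x) hG.2.2.1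
  simpa using h

lemma ising_sameCycle_th {G : RawRibbon X} (hG : G.IsRibbon) {a b : X}
    (h : G.s0.SameCycle a b) : G.s0.SameCycle (G.th a) (G.th b) := by
  obtain ⟨n, rfl⟩ := h
  have h1 : SemiconjBy G.th G.s0⁻¹ G.s0 := hG.2.2.2.2.2.1.symm
  have h2 := h1.zpow_right (-n)
  refine ⟨-n, ?_⟩
  have h3 := congrArg (fun p : Equiv.Perm X => p a) h2
  simpa using h3.symm

lemma ising_mem_vertexOf {G : RawRibbon X} (x y : X) :
    y ∈ G.vertexOf x ↔ G.s0.SameCycle x y ∨ G.s0.SameCycle (G.th x) y := by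
  simp [vertexOf, ising_mem_permOrbit]

lemma ising_vertexOf_eq {G : RawRibbon X} (hG : G.IsRibbon) {x y : X}
    (h : y ∈ G.vertexOf x) : G.vertexOf y = G.vertexOf x := by
  rw [ising_mem_vertexOf] at h
  ext z
  rw [ising_mem_vertexOf, ising_mem_vertexOf]
  rcases h with h | h
  · have h' := ising_sameCycle_th hG h
    constructor
    · rintro (k | k)
      · exact Or.inl (h.trans k)
      · exact Or.inr (h'.trans k)
    · rintro (k | k)
      · exact Or.inl (h.symm.trans k)
      · exact Or.inr (h'.symm.trans k)
  · have h' := ising_sameCycle_th hG h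
    rw [ising_th_th hG] at h'
    constructor
    · rintro (k | k)
      · exact Or.inr (h.trans k)
      · exact Or.inl (h'.trans k)
    · rintro (k | k)
      · exact Or.inr (h'.symm.trans k)
      · exact Or.inl (h.symm.trans k)

lemma ising_half_sub_vertex {G : RawRibbon X} (hG : G.IsRibbon) (x : X) {v : Finset X}
    (hv : v ∈ G.vertices) : ({x, G.th x} : Finset X) ⊆ v ↔ G.vertexOf x = v := by
  obtain ⟨y, -, rfl⟩ := Finset.mem_image.1 hv
  constructor
  · intro h
    exact ising_vertexOf_eq hG (h (by simp))
  · intro h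
    rw [← h]
    intro z hz
    rw [ising_mem_vertexOf]
    simp only [Finset.mem_insert, Finset.mem_singleton] at hz
    rcases hz with rfl | rfl
    · exact Or.inl (Equiv.Perm.SameCycle.refl _ _)
    · exact Or.inr (Equiv.Perm.SameCycle.refl _ _)

lemma ising_vertexOf_mem {G : RawRibbon X} (x : X) : G.vertexOf x ∈ G.vertices :=
  Finset.mem_image_of_mem _ (Finset.mem_univ x)

lemma ising_vertexOfHalf {G : RawRibbon X} (hG : G.IsRibbon) (x : X) :
    G.vertexOfHalf {x, G.th x} = G.vertexOf x := by
  have : (G.vertices.filter fun v => ({x, G.th x} : Finset X) ⊆ v) = {G.vertexOf x} := by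
    ext v
    simp only [Finset.mem_filter, Finset.mem_singleton]
    constructor
    · rintro ⟨hv, h⟩
      exact ((ising_half_sub_vertex hG x hv).1 h).symm
    · rintro rfl
      exact ⟨ising_vertexOf_mem x, (ising_half_sub_vertex hG x (ising_vertexOf_mem x)).2 rfl⟩
  rw [vertexOfHalf, this]
  simp

/-- The edge through a cross. -/
def isingEdge (G : RawRibbon X) (x : X) : Finset X :=
  {x, G.th x, G.s1 x, G.s1 (G.th x)}

lemma ising_edge_eq {G : RawRibbon X} (hG : G.IsRibbon) {x y : X}
    (h : y ∈ isingEdge G x) : isingEdge G y = isingEdge G x := by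
  have a := ising_th_th hG
  have b := ising_s1_s1 hG
  have c := ising_th_s1 hG
  unfold isingEdge at *
  simp only [Finset.mem_insert, Finset.mem_singleton] at h
  rcases h with rfl | rfl | rfl | rfl <;> ext z <;>
    simp only [Finset.mem_insert, Finset.mem_singleton, a, b, c] <;> tauto

lemma ising_mem_edges {G : RawRibbon X} {e : Finset X} (he : e ∈ G.edges) :
    ∃ x, isingEdge G x = e := by
  obtain ⟨x, -, h⟩ := Finset.mem_image.1 he
  exact ⟨x, h⟩

lemma ising_mem_edge_eq {G : RawRibbon X} (hG : G.IsRibbon) {x : X} {e : Finset X}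
    (he : e ∈ G.edges) (h : x ∈ e) : isingEdge G x = e := by
  obtain ⟨y, rfl⟩ := ising_mem_edges he
  exact ising_edge_eq hG h

lemma ising_flags {G : RawRibbon X} (hnf : G.NoFlags) : G.flags = ∅ := by
  unfold flags
  rw [Finset.filter_false_of_mem]
  · rfl
  · intro x _
    exact hnf x

/-- Spin values. -/
noncomputable def isingSpin (T : Finset (Finset X)) (v : Finset X) : ℝ :=
  if v ∈ T then 1 else -1

lemma ising_prod_spin {G : RawRibbon X} (hG : G.IsRibbon) (hnf : G.NoFlags)
    (T C : Finset (Finset X)) (hC : C ⊆ G.edges) :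
    ∏ e ∈ C, spinProd G T e = ∏ v ∈ G.vertices, isingSpin T v ^ G.degB C v := by
  have h1 : ∏ e ∈ C, spinProd G T e =
      ∏ h ∈ G.halfRibbons.filter (fun h => ∃ e ∈ C, h ⊆ e), isingSpin T (G.vertexOfHalf h) := by
    have : G.halfRibbons.filter (fun h => ∃ e ∈ C, h ⊆ e) =
        C.biUnion fun e => G.halfRibbons.filter fun h => h ⊆ e := by
      ext h
      simp only [Finset.mem_filter, Finset.mem_biUnion]
      tauto
    rw [this, Finset.prod_biUnion]
    · rfl
    · intro e he e' he' hne
      rw [Function.onFun, Finset.disjoint_left]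
      intro h hh hh'
      rw [Finset.mem_filter] at hh hh'
      obtain ⟨x, -, rfl⟩ := Finset.mem_image.1 hh.1
      apply hne
      rw [← ising_mem_edge_eq hG (hC he) (hh.2 (by simp : x ∈ _)),
        ← ising_mem_edge_eq hG (hC he') (hh'.2 (by simp : x ∈ _))]
  rw [h1, ← Finset.prod_fiberwise_of_maps_to (t := G.vertices) (g := G.vertexOfHalf)]
  · apply Finset.prod_congr rfl
    intro v hv
    rw [Finset.prod_congr rfl (g := fun _ => isingSpin T v)]
    · rw [Finset.prod_const]
      congr 1
      unfold degB
      congr 1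
      ext h
      simp only [Finset.mem_filter, ising_flags hnf, Finset.notMem_empty, false_or]
      constructor
      · rintro ⟨⟨a, b⟩, c⟩
        obtain ⟨x, -, rfl⟩ := Finset.mem_image.1 a
        refine ⟨a, (ising_half_sub_vertex hG x hv).2 ?_, b⟩
        rw [← ising_vertexOfHalf hG, c]
      · rintro ⟨a, b, c⟩
        obtain ⟨x, -, rfl⟩ := Finset.mem_image.1 a
        refine ⟨⟨a, c⟩, ?_⟩
        rw [ising_vertexOfHalf hG]
        exact (ising_half_sub_vertex hG x hv).1 b
    · intro h hh
      rw [(Finset.mem_filter.1 hh).2]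
  · intro h hh
    obtain ⟨x, -, rfl⟩ := Finset.mem_image.1 (Finset.mem_filter.1 hh).1
    rw [ising_vertexOfHalf hG]
    exact ising_vertexOf_mem x

lemma ising_spin_sum (V : Finset (Finset X)) (d : Finset X → ℕ) :
    ∑ T ∈ V.powerset, ∏ v ∈ V, isingSpin T v ^ d v =
      ∏ v ∈ V, (if Even (d v) then (2 : ℝ) else 0) := by
  have h : ∀ v ∈ V, (if Even (d v) then (2 : ℝ) else 0) = 1 + (-1) ^ d v := by
    intro v _
    split_ifs with he
    · rw [he.neg_one_pow]; norm_num
    · rw [(Nat.not_even_iff_odd.1 he).neg_one_pow]; norm_num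
  rw [Finset.prod_congr rfl h, Finset.prod_add]
  apply Finset.sum_congr rfl
  intro T hT
  rw [Finset.mem_powerset] at hT
  rw [← Finset.prod_sdiff hT, mul_comm]
  congr 1
  · apply Finset.prod_congr rfl
    intro v hv
    simp [isingSpin, hv]
  · apply Finset.prod_congr rfl
    intro v hv
    simp [isingSpin, (Finset.mem_sdiff.1 hv).2]

lemma ising_exp {G : RawRibbon X} (T : Finset (Finset X)) (e : Finset X) (a : ℝ) :
    Real.exp (a * spinProd G T e) = Real.sinh a * spinProd G T e + Real.cosh a := by
  have h : spinProd G T e = 1 ∨ spinProd G T e = -1 := by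
    unfold spinProd
    apply Finset.prod_induction _ (fun r : ℝ => r = 1 ∨ r = -1)
    · rintro a b (rfl | rfl) (rfl | rfl) <;> simp
    · simp
    · intro h _
      split_ifs <;> simp
  rcases h with h | h <;> rw [h]
  · rw [mul_one, mul_one, Real.sinh_add_cosh]
  · rw [mul_neg_one, mul_neg_one, ← Real.cosh_sub_sinh]; ring

lemma ising_main {G : RawRibbon X} (hG : G.IsRibbon) (hnf : G.NoFlags) (a : Finset X → ℝ) :
    (∑ T ∈ G.vertices.powerset, ∏ e ∈ G.edges, Real.exp (a e * spinProd G T e)) =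
      ∑ C ∈ G.edges.powerset, (∏ e ∈ G.edges \ C, Real.cosh (a e)) *
        (∏ e ∈ C, Real.sinh (a e)) *
          ∏ v ∈ G.vertices, (if Even (G.degB C v) then (2 : ℝ) else 0) := by
  simp_rw [ising_exp, Finset.prod_add, Finset.prod_mul_distrib]
  rw [Finset.sum_comm]
  apply Finset.sum_congr rfl
  intro C hC
  rw [Finset.mem_powerset] at hC
  rw [← ising_spin_sum, Finset.mul_sum]
  apply Finset.sum_congr rfl
  intro T _
  rw [ising_prod_spin hG hnf T C hC]
  ring

lemma ising_restrict_apply (f : Equiv.Perm X) (S : Finset X) (h : ∀ x, x ∈ S ↔ f x ∈ S) (x : X) :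
    permRestrict f S x = if x ∈ S then f x else x := by
  unfold permRestrict
  rw [dif_pos h]
  split_ifs with hx
  · rw [Equiv.Perm.ofSubtype_apply_of_mem _ hx]
    rfl
  · rw [Equiv.Perm.ofSubtype_apply_of_not_mem _ hx]

lemma ising_partialDual_empty (G : RawRibbon X) : G.partialDual ∅ = G := by
  have h0 : ∀ f : Equiv.Perm X, permRestrict f ∅ = 1 := by
    intro f
    ext x
    rw [ising_restrict_apply _ _ (by simp)]
    simp
  have h1 : ∀ f : Equiv.Perm X, permRestrict f (Finset.univ) = f := by
    intro f
    ext x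
    rw [ising_restrict_apply _ _ (by simp)]
    simp
  have hc : crossSet (∅ : Finset (Finset X)) = ∅ := rfl
  unfold partialDual
  rw [hc, Finset.compl_empty]
  simp [h0, h1]

lemma ising_edge_mem_dual {G : RawRibbon X} (hG : G.IsRibbon)
    {A : Finset (Finset X)} (hA : A ⊆ G.edges) {e : Finset X} (he : e ∈ A) :
    e ∈ (G.partialDual A).edges := by
  have key : ∀ f : Equiv.Perm X, (∀ x, f (f x) = x) → (∀ x, f x ∈ isingEdge G x) →
      ∀ x, x ∈ crossSet A ↔ f x ∈ crossSet A := by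
    intro f hf hfe
    have : ∀ x, x ∈ crossSet A → f x ∈ crossSet A := by
      intro x hx
      unfold crossSet at *
      rw [Finset.mem_biUnion] at *
      obtain ⟨e, he, hxe⟩ := hx
      refine ⟨e, he, ?_⟩
      have := hfe x
      rwa [ising_mem_edge_eq hG (hA he) hxe] at this
    intro x
    refine ⟨this x, fun h => ?_⟩
    have := this _ h
    rwa [hf] at this
  have kth := key G.th (ising_th_th hG) (by simp [isingEdge])
  have ks1 := key G.s1 (ising_s1_s1 hG) (by simp [isingEdge])
  have kth' : ∀ x, x ∈ (crossSet A)ᶜ ↔ G.th x ∈ (crossSet A)ᶜ := by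
    intro x; simp only [Finset.mem_compl, ← kth x]
  have ks1' : ∀ x, x ∈ (crossSet A)ᶜ ↔ G.s1 x ∈ (crossSet A)ᶜ := by
    intro x; simp only [Finset.mem_compl, ← ks1 x]
  obtain ⟨x, rfl⟩ := ising_mem_edges (hA he)
  have hx : x ∈ crossSet A := by
    unfold crossSet
    rw [Finset.mem_biUnion]
    exact ⟨_, he, by simp [isingEdge]⟩
  have hd : ∀ y ∈ crossSet A, (G.partialDual A).th y = G.s1 y ∧
      (G.partialDual A).s1 y = G.th y := by
    intro y hy
    have hy1 := (kth y).1 hy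
    constructor
    · simp [partialDual, ising_restrict_apply _ _ kth', ising_restrict_apply _ _ ks1, hy]
    · simp [partialDual, ising_restrict_apply _ _ kth, ising_restrict_apply _ _ ks1', hy, hy1]
  unfold edges
  rw [Finset.mem_image]
  refine ⟨x, ?_, ?_⟩
  · rw [Finset.mem_filter, (hd x hx).2]
    exact ⟨Finset.mem_univ _, hG.2.2.2.1 x⟩
  · rw [(hd x hx).1, (hd x hx).2, (hd _ ((ks1 x).1 hx)).2, ising_th_s1 hG]
    ext z
    simp only [isingEdge, Finset.mem_insert, Finset.mem_singleton]
    tauto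

lemma ising_Q {G : RawRibbon X} (hG : G.IsRibbon) (x w : Finset X → ℝ) (r : ℕ → ℝ) :
    Qpoly G x (fun _ => 0) (fun _ => 0) w r =
      ∑ C ∈ G.edges.powerset, (∏ e ∈ G.edges \ C, x e) * (∏ e ∈ C, w e) *
        ∏ v ∈ G.vertices, r (G.degB C v) := by
  unfold Qpoly
  rw [Finset.sum_eq_single ∅]
  · rw [ising_partialDual_empty]
    apply Finset.sum_congr rfl
    intro C hC
    rw [Finset.mem_powerset] at hC
    simp [Finset.inter_eq_right.2 hC, Finset.inter_eq_right.2 (Finset.sdiff_subset : G.edges \ C ⊆ G.edges)]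
  · intro A hA hne
    rw [Finset.mem_powerset] at hA
    obtain ⟨e, he⟩ := Finset.nonempty_iff_ne_empty.2 hne
    have hed := ising_edge_mem_dual hG hA he
    apply Finset.sum_eq_zero
    intro B _
    by_cases hB : e ∈ B
    · rw [Finset.prod_eq_zero (s := A ∩ B) (i := e) (by simp [he, hB]) rfl]
      simp
    · rw [Finset.prod_eq_zero (s := A ∩ ((G.partialDual A).edges \ B)) (i := e)
        (by simp [he, hB, hed]) rfl]
      simp
  · intro h
    simp at h

end Ising

end RawRibbon

end RibbonPaper

open RibbonPaper RawRibbon in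
/-- high-temperature expansion of the Ising model. -/
theorem statement_12 {X : Type} [Fintype X] [DecidableEq X]
    (G : RawRibbon X) (hG : G.IsRibbon) (hnf : G.NoFlags) (β : ℝ) (J : Finset X → ℝ) :
    (∑ T ∈ G.vertices.powerset, ∏ e ∈ G.edges, Real.exp (β * J e * spinProd G T e)) =
        Qpoly G (fun e => Real.cosh (β * J e)) (fun _ => 0) (fun _ => 0)
          (fun e => Real.sinh (β * J e)) (fun n => if Even n then 2 else 0) ∧
      (∑ T ∈ G.vertices.powerset, ∏ e ∈ G.edges, Real.exp (β * J e * spinProd G T e)) =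
        2 ^ G.vertices.card *
          ∑ C ∈ G.edges.powerset.filter (fun C => ∀ v ∈ G.vertices, Even (G.degB C v)),
            (∏ e ∈ G.edges \ C, Real.cosh (β * J e)) * ∏ e ∈ C, Real.sinh (β * J e) := by
  refine ⟨?_, ?_⟩
  · rw [ising_Q hG, ising_main hG hnf]
  · rw [ising_main hG hnf, Finset.mul_sum, Finset.sum_filter]
    apply Finset.sum_congr rfl
    intro C _
    split_ifs with h
    · rw [Finset.prod_congr rfl (g := fun _ => (2 : ℝ)) (fun v hv => if_pos (h v hv)),
        Finset.prod_const]
      ring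
    · push Not at h
      obtain ⟨v, hv, hne⟩ := h
      rw [Finset.prod_eq_zero (s := G.vertices) hv (if_neg hne), mul_zero]
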